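/- Let N ≥ 1, let ℓ ≥ 1 be an integer, and let φ : Λ_N → ℤ≥0. For A ⊆ φ^{−1}(ℓ), define V_A φ : Λ_N → ℤ≥0 by (V_A φ)(x) = 0 if φ(x) = 0, (V_A φ)(x) = 1 if x ∈ A, and (V_A φ)(x) = φ(x) + 1 otherwise. Then H_N(V_A φ) ≤ H_N(φ) + 4N + 4|φ^{−1}(0)| + 4ℓ|A|, and moreover |(V_A φ)^{−1}(0)| = |φ^{−1}(0)|. -/

import Mathlib

open Real Finset
open scoped Classical

noncomputable section

/-- The box `Λ_N = {1,…,N}²` in `ℤ²`. -/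
def Lam (N : ℕ) : Finset (ℤ × ℤ) := Finset.Icc (1:ℤ) (N:ℤ) ×ˢ Finset.Icc (1:ℤ) (N:ℤ)

/-- The four nearest neighbors of a site of `ℤ²`. -/
def nbrs (x : ℤ × ℤ) : Finset (ℤ × ℤ) :=
  {(x.1 + 1, x.2), (x.1 - 1, x.2), (x.1, x.2 + 1), (x.1, x.2 - 1)}

/-- An enlarged box containing all edges touching `Λ_N`. -/
def Box (N : ℕ) : Finset (ℤ × ℤ) := Finset.Icc (0:ℤ) ((N:ℤ)+1) ×ˢ Finset.Icc (0:ℤ) ((N:ℤ)+1)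

/-- The SOS Hamiltonian with zero boundary conditions, for fields vanishing outside `Λ_N`:
each edge `{x,y}` with `x ~ y` touching `Λ_N` is counted twice in the double sum (once from
each endpoint, both endpoints lying in `Box N`), whence the factor `1/2`.  Since the field
vanishes outside `Λ_N`, this equals
`Σ_{{x,y}⊂Λ_N, x~y} |φ(x)−φ(y)| + Σ_{x∈Λ_N, y∉Λ_N, x~y} |φ(x)|`. -/
def Ham (N : ℕ) (φ : ℤ × ℤ → ℤ) : ℝ :=
  (1/2) * ∑ x ∈ Box N, ∑ y ∈ nbrs x, |(φ x : ℝ) - (φ y : ℝ)|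

/-- The level set `φ⁻¹(k)` inside `Λ_N`. -/
def levelSet (N : ℕ) (φ : ℤ × ℤ → ℤ) (k : ℤ) : Finset (ℤ × ℤ) :=
  (Lam N).filter fun x => φ x = k

/-- The configuration space `Ω_N`: nonnegative integer fields vanishing outside `Λ_N`. -/
def Conf (N : ℕ) : Type :=
  {φ : ℤ × ℤ → ℤ // (∀ x, 0 ≤ φ x) ∧ ∀ x ∉ Lam N, φ x = 0}

/-- The Boltzmann weight `exp(−β H_N(φ) + h |φ⁻¹(0)|)`. -/
def weight (N : ℕ) (β h : ℝ) (φ : ℤ × ℤ → ℤ) : ℝ :=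
  Real.exp (-β * Ham N φ + h * ((levelSet N φ 0).card : ℝ))

/-- The partition function `Z_N^{β,h}`. -/
def Z (N : ℕ) (β h : ℝ) : ℝ := ∑' φ : Conf N, weight N β h φ.val

/-- The probability of an event `E ⊆ Ω_N` under `P_N^{β,h}`. -/
def prob (N : ℕ) (β h : ℝ) (E : Set (Conf N)) : ℝ :=
  (∑' φ : Conf N, if φ ∈ E then weight N β h φ.val else 0) / Z N β h

/-- The critical pinning value `h_w(β) = log(e^{4β}/(e^{4β}−1))`. -/
def hw (β : ℝ) : ℝ := Real.log (Real.exp (4*β) / (Real.exp (4*β) - 1))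

/-- The map `V_A`: keep zeros of `φ` at height `0`, put sites of `A` at height `1`, and raise
everything else on `Λ_N` by one (extending by `0` outside `Λ_N`). -/
def VA (N : ℕ) (A : Finset (ℤ × ℤ)) (φ : ℤ × ℤ → ℤ) : ℤ × ℤ → ℤ :=
  fun x => if x ∈ Lam N then (if φ x = 0 then 0 else if x ∈ A then 1 else φ x + 1) else 0

lemma sum_nbrs (f : ℤ × ℤ → ℝ) (x : ℤ × ℤ) :
    ∑ y ∈ nbrs x, f y = f (x + (1, 0)) + f (x + (-1, 0)) + f (x + (0, 1)) + f (x + (0, -1)) := by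
  obtain ⟨a, b⟩ := x
  unfold nbrs
  rw [Finset.sum_insert, Finset.sum_insert, Finset.sum_insert, Finset.sum_singleton]
  · simp only [Prod.mk_add_mk, add_zero, ← sub_eq_add_neg]
    ring
  all_goals
    simp only [Finset.mem_insert, Finset.mem_singleton, Prod.mk.injEq]
    omega

/-- The Hamiltonian as a sum over the four lattice directions. -/
lemma Ham_eq_sum_directions (N : ℕ) (φ : ℤ × ℤ → ℤ) :
    Ham N φ = (1/2) * (∑ x ∈ Box N, |(φ x : ℝ) - φ (x + (1, 0))|
      + ∑ x ∈ Box N, |(φ x : ℝ) - φ (x + (-1, 0))|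
      + ∑ x ∈ Box N, |(φ x : ℝ) - φ (x + (0, 1))|
      + ∑ x ∈ Box N, |(φ x : ℝ) - φ (x + (0, -1))|) := by
  unfold Ham
  rw [← Finset.sum_add_distrib, ← Finset.sum_add_distrib, ← Finset.sum_add_distrib]
  congr 1
  exact Finset.sum_congr rfl fun x _ => sum_nbrs (fun y => |(φ x : ℝ) - φ y|) x

lemma sum_indicator_shift_le (B S : Finset (ℤ × ℤ)) (e : ℤ × ℤ) :
    ∑ x ∈ B, (if x + e ∈ S then (1:ℝ) else 0) ≤ S.card := by
  rw [Finset.sum_boole]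
  exact_mod_cast Finset.card_le_card_of_injOn (fun x => x + e)
    (fun x hx => (Finset.mem_filter.1 hx).2) (fun x _ y _ h => add_right_cancel h)

lemma sum_indicator_le_of_subset {N : ℕ} (B S : Finset (ℤ × ℤ)) (p : ℤ × ℤ → Prop) [DecidablePred p]
    (hp : ∀ x, p x → x ∈ S) (hS : S.card = N) :
    ∑ x ∈ B, (if p x then (1:ℝ) else 0) ≤ N := by
  rw [Finset.sum_boole, ← hS]
  exact_mod_cast Finset.card_le_card fun x hx => hp x (Finset.mem_filter.1 hx).2

/-- Raising across a single edge costs `ℓ` per endpoint in `A`, `1` per endpoint in the zero set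
and `1` if the edge crosses the boundary of the box. -/
lemma abs_VA_sub_VA_le {N : ℕ} {ℓ : ℤ} (hℓ : 1 ≤ ℓ) (φ : Conf N) {A : Finset (ℤ × ℤ)}
    (hA : A ⊆ levelSet N φ.val ℓ) (x y : ℤ × ℤ) :
    |(VA N A φ.val x : ℝ) - VA N A φ.val y| ≤ |(φ.val x : ℝ) - φ.val y|
      + ℓ * (if x ∈ A then 1 else 0) + ℓ * (if y ∈ A then 1 else 0)
      + (if x ∈ levelSet N φ.val 0 then 1 else 0) + (if y ∈ levelSet N φ.val 0 then 1 else 0)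
      + (if x ∈ Lam N ∧ y ∉ Lam N then 1 else 0)
      + (if x ∉ Lam N ∧ y ∈ Lam N then 1 else 0) := by
  have key : |VA N A φ.val x - VA N A φ.val y| ≤ |φ.val x - φ.val y|
      + ℓ * (if x ∈ A then 1 else 0) + ℓ * (if y ∈ A then 1 else 0)
      + (if x ∈ levelSet N φ.val 0 then 1 else 0) + (if y ∈ levelSet N φ.val 0 then 1 else 0)
      + (if x ∈ Lam N ∧ y ∉ Lam N then 1 else 0)
      + (if x ∉ Lam N ∧ y ∈ Lam N then 1 else 0) := by
    have hval : ∀ z ∈ A, z ∈ Lam N ∧ φ.val z = ℓ := fun z hz => Finset.mem_filter.1 (hA hz)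
    have hx := φ.2.1 x
    have hy := φ.2.1 y
    have hx0 := φ.2.2 x
    have hy0 := φ.2.2 y
    have hxA := hval x
    have hyA := hval y
    simp only [VA, levelSet, Finset.mem_filter]
    by_cases h1 : x ∈ Lam N <;> by_cases h2 : y ∈ Lam N <;>
      by_cases h3 : x ∈ A <;> by_cases h4 : y ∈ A <;>
      by_cases h5 : φ.val x = 0 <;> by_cases h6 : φ.val y = 0 <;>
      simp only [h1, h2, h3, h4, h5, h6, if_true, if_false, true_and, false_and, and_true,
        and_false, not_true, not_false_iff, true_implies, false_implies] at * <;>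
      grind
  exact_mod_cast key

/-- Summed energy estimate in one lattice direction. -/
lemma sum_abs_VA_sub_shift_le {N : ℕ} {ℓ : ℤ} (hℓ : 1 ≤ ℓ) (φ : Conf N) {A : Finset (ℤ × ℤ)}
    (hA : A ⊆ levelSet N φ.val ℓ) (e : ℤ × ℤ) {S T : Finset (ℤ × ℤ)}
    (hS : ∀ x, x ∈ Lam N ∧ x + e ∉ Lam N → x ∈ S) (hScard : S.card = N)
    (hT : ∀ x, x ∉ Lam N ∧ x + e ∈ Lam N → x ∈ T) (hTcard : T.card = N) :
    ∑ x ∈ Box N, |(VA N A φ.val x : ℝ) - VA N A φ.val (x + e)|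
      ≤ ∑ x ∈ Box N, |(φ.val x : ℝ) - φ.val (x + e)|
        + 2 * ℓ * A.card + 2 * (levelSet N φ.val 0).card + 2 * N := by
  have h := Finset.sum_le_sum fun x (_ : x ∈ Box N) => abs_VA_sub_VA_le hℓ φ hA x (x + e)
  simp only [Finset.sum_add_distrib, ← Finset.mul_sum] at h
  have hℓ' : (0:ℝ) ≤ ℓ := by exact_mod_cast (by omega : 0 ≤ ℓ)
  have a1 := mul_le_mul_of_nonneg_left (sum_indicator_shift_le (Box N) A 0) hℓ'
  have a2 := mul_le_mul_of_nonneg_left (sum_indicator_shift_le (Box N) A e) hℓ'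
  have z1 := sum_indicator_shift_le (Box N) (levelSet N φ.val 0) 0
  have z2 := sum_indicator_shift_le (Box N) (levelSet N φ.val 0) e
  have b1 := sum_indicator_le_of_subset (Box N) S (fun x => x ∈ Lam N ∧ x + e ∉ Lam N) hS hScard
  have b2 := sum_indicator_le_of_subset (Box N) T (fun x => x ∉ Lam N ∧ x + e ∈ Lam N) hT hTcard
  simp only [add_zero] at a1 z1
  linarith

lemma levelSet_VA_zero (N : ℕ) (A : Finset (ℤ × ℤ)) (φ : Conf N) :
    levelSet N (VA N A φ.val) 0 = levelSet N φ.val 0 := by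
  refine Finset.filter_congr fun x hx => ?_
  have h := φ.2.1 x
  simp only [VA, hx, if_true]
  split_ifs <;> omega

/-- Energy estimate for the map `V_A` at level `ℓ ≥ 1`:
`H_N(V_A φ) ≤ H_N(φ) + 4N + 4|φ⁻¹(0)| + 4ℓ|A|`, and `|(V_A φ)⁻¹(0)| = |φ⁻¹(0)|`. -/
theorem Ham_VA_le (N : ℕ) (hN : 1 ≤ N) (ℓ : ℤ) (hℓ : 1 ≤ ℓ)
    (φ : Conf N) (A : Finset (ℤ × ℤ)) (hA : A ⊆ levelSet N φ.val ℓ) :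
    Ham N (VA N A φ.val) ≤ Ham N φ.val + 4 * (N:ℝ)
        + 4 * ((levelSet N φ.val 0).card : ℝ) + 4 * (ℓ:ℝ) * (A.card : ℝ) ∧
      (levelSet N (VA N A φ.val) 0).card = (levelSet N φ.val 0).card := by
  refine ⟨?_, by rw [levelSet_VA_zero]⟩
  rw [Ham_eq_sum_directions, Ham_eq_sum_directions]
  have right := sum_abs_VA_sub_shift_le hℓ φ hA (1, 0)
    (S := {(N:ℤ)} ×ˢ Finset.Icc (1:ℤ) N) (T := {(0:ℤ)} ×ˢ Finset.Icc (1:ℤ) N)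
    (by simp [Lam]; omega) (by simp) (by simp [Lam]; omega) (by simp)
  have left := sum_abs_VA_sub_shift_le hℓ φ hA (-1, 0)
    (S := {(1:ℤ)} ×ˢ Finset.Icc (1:ℤ) N) (T := {(N:ℤ) + 1} ×ˢ Finset.Icc (1:ℤ) N)
    (by simp [Lam]; omega) (by simp) (by simp [Lam]; omega) (by simp)
  have up := sum_abs_VA_sub_shift_le hℓ φ hA (0, 1)
    (S := Finset.Icc (1:ℤ) N ×ˢ {(N:ℤ)}) (T := Finset.Icc (1:ℤ) N ×ˢ {(0:ℤ)})
    (by simp [Lam]; omega) (by simp) (by simp [Lam]; omega) (by simp)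
  have down := sum_abs_VA_sub_shift_le hℓ φ hA (0, -1)
    (S := Finset.Icc (1:ℤ) N ×ˢ {(1:ℤ)}) (T := Finset.Icc (1:ℤ) N ×ˢ {(N:ℤ) + 1})
    (by simp [Lam]; omega) (by simp) (by simp [Lam]; omega) (by simp)
  linarith
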